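/- The fixed point ω is the unique left-special element of Ω⁺: an infinite word V ∈ Ω⁺ admits two distinct letters a, b ∈ A with aV ∈ Ω⁺ and bV ∈ Ω⁺ (where aV denotes the infinite word obtained by prepending the letter a to V) if and only if V = ω. -/

import Mathlib

/-- The substitution σ on the alphabet A = {1, …, d}:
σ(1) = 12, σ(k) = k+1 for 2 ≤ k ≤ d−1, σ(d) = 1. Letters are literal natural numbers. -/
def sig (d : ℕ) (a : ℕ) : List ℕ :=
  if a = 1 then [1, 2] else if a = d then [1] else [a + 1]

/-- Extension of a substitution to finite words by concatenation. -/
def applySub (f : ℕ → List ℕ) : List ℕ → List ℕ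
  | [] => []
  | a :: w => f a ++ applySub f w

/-- σⁿ applied to a word. -/
def sigIter (d n : ℕ) (w : List ℕ) : List ℕ := (applySub (sig d))^[n] w

/-- The language L(Ω): the set of finite factors of the fixed point ω, i.e. of the
words σⁿ(1). -/
def Lang (d : ℕ) (u : List ℕ) : Prop := ∃ n : ℕ, u <:+: sigIter d n [1]

/-- `w` is a (finite) prefix of the infinite word `V`. -/
def PrefixOfInf (w : List ℕ) (V : ℕ → ℕ) : Prop :=
  ∀ (i : ℕ) (h : i < w.length), w.get ⟨i, h⟩ = V i

/-- `ω` is the fixed point of σ: the unique infinite word admitting every σⁿ(1) as a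
prefix. -/
def IsSigmaFixedPoint (d : ℕ) (ω : ℕ → ℕ) : Prop :=
  ∀ n : ℕ, PrefixOfInf (sigIter d n [1]) ω

/-- `u` is left-special: there are distinct letters a, b ∈ A with au, bu ∈ L(Ω). -/
def LeftSpecial (d : ℕ) (u : List ℕ) : Prop :=
  ∃ a b : ℕ, a ≠ b ∧ 1 ≤ a ∧ a ≤ d ∧ 1 ≤ b ∧ b ≤ d ∧
    Lang d (a :: u) ∧ Lang d (b :: u)

/-- `u` is right-special: there are distinct letters a, b ∈ A with ua, ub ∈ L(Ω). -/
def RightSpecial (d : ℕ) (u : List ℕ) : Prop :=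
  ∃ a b : ℕ, a ≠ b ∧ 1 ≤ a ∧ a ≤ d ∧ 1 ≤ b ∧ b ≤ d ∧
    Lang d (u ++ [a]) ∧ Lang d (u ++ [b])

/-- `u` is bispecial: both left- and right-special. -/
def Bispecial (d : ℕ) (u : List ℕ) : Prop := LeftSpecial d u ∧ RightSpecial d u

/-- The shift S on infinite words. -/
def shiftMap (V : ℕ → ℕ) : ℕ → ℕ := fun i => V (i + 1)

/-- Ω⁺ : the closure (for the product topology, letters discrete) of the shift
orbit of ω. -/
def OmegaPlus (ω : ℕ → ℕ) : Set (ℕ → ℕ) :=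
  closure {V : ℕ → ℕ | ∃ n : ℕ, V = shiftMap^[n] ω}

/-- The cylinder C_u = {V ∈ Ω⁺ : u is a prefix of V}. -/
def Cyl (ω : ℕ → ℕ) (u : List ℕ) : Set (ℕ → ℕ) :=
  {V | V ∈ OmegaPlus ω ∧ PrefixOfInf u V}

/-- Prepending a letter to an infinite word. -/
def consInf (a : ℕ) (V : ℕ → ℕ) : ℕ → ℕ :=
  fun i => match i with
  | 0 => a
  | j + 1 => V j

/-- Extension of σ to infinite words: σ(V) = σ(V₀)σ(V₁)σ(V₂)⋯ (each σ(a) is a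
nonempty word, so the n-th letter of σ(V) is the n-th letter of σ(V₀…Vₙ)). -/
def sigInf (d : ℕ) (V : ℕ → ℕ) : ℕ → ℕ :=
  fun n => (applySub (sig d) ((List.range (n + 1)).map V)).getD n 0

/-- Concatenation of a finite list of words. -/
def concatAll : List (List ℕ) → List ℕ
  | [] => []
  | w :: ws => w ++ concatAll ws

section Substitution

variable {d : ℕ}

theorem applySub_append (f : ℕ → List ℕ) (u v : List ℕ) :
    applySub f (u ++ v) = applySub f u ++ applySub f v := by
  induction u with
  | nil => rfl
  | cons a u ih => simp [applySub, ih]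

theorem applySub_prefix (f : ℕ → List ℕ) {u v : List ℕ} (h : u <+: v) :
    applySub f u <+: applySub f v := by
  obtain ⟨t, rfl⟩ := h
  exact ⟨applySub f t, (applySub_append f u t).symm⟩

theorem applySub_infix (f : ℕ → List ℕ) {u v : List ℕ} (h : u <:+: v) :
    applySub f u <:+: applySub f v := by
  obtain ⟨s, t, rfl⟩ := h
  exact ⟨applySub f s, applySub f t, by simp [applySub_append]⟩

theorem sigIter_zero (w : List ℕ) : sigIter d 0 w = w := rfl

theorem sigIter_succ (n : ℕ) (w : List ℕ) :
    sigIter d (n + 1) w = applySub (sig d) (sigIter d n w) :=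
  Function.iterate_succ_apply' _ _ _

theorem sigIter_succ' (n : ℕ) (w : List ℕ) :
    sigIter d (n + 1) w = sigIter d n (applySub (sig d) w) :=
  Function.iterate_succ_apply _ _ _

theorem sigIter_append (n : ℕ) (u v : List ℕ) :
    sigIter d n (u ++ v) = sigIter d n u ++ sigIter d n v := by
  induction n with
  | zero => rfl
  | succ n ih => simp [sigIter_succ, ih, applySub_append]

theorem Lang.of_infix {u v : List ℕ} (hv : Lang d v) (h : u <:+: v) : Lang d u := by
  obtain ⟨n, hn⟩ := hv
  exact ⟨n, h.trans hn⟩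

theorem Lang.applySub_sig {u : List ℕ} (hu : Lang d u) : Lang d (applySub (sig d) u) := by
  obtain ⟨n, hn⟩ := hu
  exact ⟨n + 1, by rw [sigIter_succ]; exact applySub_infix _ hn⟩

theorem Lang.sigIter {u : List ℕ} (hu : Lang d u) (n : ℕ) : Lang d (sigIter d n u) := by
  induction n with
  | zero => exact hu
  | succ n ih => rw [sigIter_succ]; exact ih.applySub_sig

theorem exists_sigIter_one_eq_cons (n : ℕ) : ∃ w, sigIter d n [1] = 1 :: w := by
  induction n with
  | zero => exact ⟨[], rfl⟩
  | succ n ih =>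
    obtain ⟨w, hw⟩ := ih
    exact ⟨2 :: applySub (sig d) w, by simp [sigIter_succ, hw, applySub, sig]⟩

theorem length_le_length_applySub_sig (w : List ℕ) :
    w.length ≤ (applySub (sig d) w).length := by
  induction w with
  | nil => simp
  | cons a w ih =>
    have : 1 ≤ (sig d a).length := by unfold sig; split_ifs <;> simp
    simp only [applySub, List.length_append, List.length_cons]
    omega

theorem lt_length_sigIter_one (n : ℕ) : n < (sigIter d n [1]).length := by
  induction n with
  | zero => simp [sigIter_zero]
  | succ n ih =>
    obtain ⟨w, hw⟩ := exists_sigIter_one_eq_cons (d := d) n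
    have := length_le_length_applySub_sig (d := d) w
    rw [hw] at ih
    simp only [sigIter_succ, hw, applySub, sig, if_true, List.length_append, List.length_cons,
      List.length_nil] at ih ⊢
    omega

theorem applySub_sig_mem_Icc (hd : 3 ≤ d) {w : List ℕ} (hw : ∀ x ∈ w, 1 ≤ x ∧ x ≤ d) :
    ∀ x ∈ applySub (sig d) w, 1 ≤ x ∧ x ≤ d := by
  induction w with
  | nil => simp [applySub]
  | cons a w ih =>
    have ha := hw a (by simp)
    intro x hx
    rw [applySub, List.mem_append] at hx
    rcases hx with hx | hx
    · unfold sig at hx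
      split_ifs at hx <;> simp at hx <;> omega
    · exact ih (fun y hy => hw y (by simp [hy])) x hx

theorem sigIter_one_mem_Icc (hd : 3 ≤ d) (n : ℕ) : ∀ x ∈ sigIter d n [1], 1 ≤ x ∧ x ≤ d := by
  induction n with
  | zero => simp [sigIter_zero]; omega
  | succ n ih => rw [sigIter_succ]; exact applySub_sig_mem_Icc hd ih

theorem Lang.mem_Icc (hd : 3 ≤ d) {u : List ℕ} (hu : Lang d u) : ∀ x ∈ u, 1 ≤ x ∧ x ≤ d := by
  obtain ⟨n, hn⟩ := hu
  exact fun x hx => sigIter_one_mem_Icc hd n x (hn.subset hx)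

/-- The successions of letters that can occur in the language: every letter other than `1` is
preceded by its predecessor. -/
abbrev Succession (x y : ℕ) : Prop := y = 1 ∨ y = x + 1

theorem isChain_applySub_sig {w : List ℕ} (hw : ∀ x ∈ w, 1 ≤ x ∧ x ≤ d)
    (hc : w.IsChain Succession) : (applySub (sig d) w).IsChain Succession := by
  induction w with
  | nil => simp [applySub]
  | cons a w ih =>
    have hih := ih (fun y hy => hw y (by simp [hy])) hc.tail
    have ha := hw a (by simp)
    rw [applySub]
    refine List.IsChain.append ?_ hih ?_
    · unfold sig; split_ifs <;> simp [Succession]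
    · cases w with
      | nil => simp [applySub]
      | cons b w =>
        have hb := hw b (by simp)
        have hab : Succession a b := (List.isChain_cons_cons.1 hc).1
        intro x hx y hy
        unfold Succession at hab ⊢
        unfold applySub sig at hy
        unfold sig at hx
        split_ifs at hx hy <;> simp at hx hy <;> omega

theorem Lang.isChain (hd : 3 ≤ d) {u : List ℕ} (hu : Lang d u) : u.IsChain Succession := by
  obtain ⟨n, hn⟩ := hu
  refine List.IsChain.infix ?_ hn
  clear hn
  induction n with
  | zero => simp [sigIter_zero]
  | succ n ih =>
    rw [sigIter_succ]
    exact isChain_applySub_sig (sigIter_one_mem_Icc hd n) ih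

/-- Desubstitution: replaces each block `σ(a)` by `a`, dropping a final `1`, whose block is
undetermined. -/
def desub (d : ℕ) : List ℕ → List ℕ
  | [] => []
  | x :: w =>
    if x = 1 then
      match w with
      | [] => []
      | y :: _ => if y = 2 then desub d w else d :: desub d w
    else (x - 1) :: desub d w

theorem desub_cons_of_ne_one {x : ℕ} (hx : x ≠ 1) (w : List ℕ) :
    desub d (x :: w) = (x - 1) :: desub d w := by
  simp [desub, hx]

theorem desub_one_two (w : List ℕ) : desub d (1 :: 2 :: w) = 1 :: desub d w := by
  simp [desub]

theorem desub_one_cons {y : ℕ} (hy : y ≠ 2) (w : List ℕ) :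
    desub d (1 :: y :: w) = d :: desub d (y :: w) := by
  rw [desub]; simp [hy]

theorem desub_suffix_cons (x : ℕ) (w : List ℕ) : desub d w <:+ desub d (x :: w) := by
  by_cases hx : x = 1
  · subst hx
    cases w with
    | nil => simp [desub]
    | cons y w =>
      by_cases hy : y = 2
      · subst hy
        rw [desub_one_two, desub_cons_of_ne_one (by norm_num)]
      · rw [desub_one_cons hy]
        exact List.suffix_cons _ _
  · rw [desub_cons_of_ne_one hx]
    exact List.suffix_cons _ _

theorem desub_suffix_append (s w : List ℕ) : desub d w <:+ desub d (s ++ w) := by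
  induction s with
  | nil => simp
  | cons x s ih => exact ih.trans (desub_suffix_cons x _)

theorem desub_prefix_append (w t : List ℕ) : desub d w <+: desub d (w ++ t) := by
  induction w with
  | nil => simp [desub]
  | cons x w ih =>
    by_cases hx : x = 1
    · subst hx
      cases w with
      | nil => simp [desub]
      | cons y w =>
        by_cases hy : y = 2
        · subst hy
          simpa [desub] using ih
        · rw [List.cons_append, List.cons_append, desub_one_cons hy, desub_one_cons hy]
          exact List.cons_prefix_cons.2 ⟨rfl, ih⟩
    · rw [List.cons_append, desub_cons_of_ne_one hx, desub_cons_of_ne_one hx]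
      exact List.cons_prefix_cons.2 ⟨rfl, ih⟩

theorem desub_infix {u v : List ℕ} (h : u <:+: v) : desub d u <:+: desub d v := by
  obtain ⟨s, t, rfl⟩ := h
  exact (desub_suffix_append s u).isInfix.trans (desub_prefix_append (s ++ u) t).isInfix

theorem applySub_sig_ne_two_cons {w : List ℕ} (hw : ∀ x ∈ w, 1 ≤ x ∧ x ≤ d) (v : List ℕ) :
    applySub (sig d) w ≠ 2 :: v := by
  cases w with
  | nil => simp [applySub]
  | cons a w =>
    have ha := hw a (by simp)
    unfold applySub sig
    split_ifs <;> simp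
    omega

theorem desub_applySub_sig_prefix (hd : 3 ≤ d) {w : List ℕ} (hw : ∀ x ∈ w, 1 ≤ x ∧ x ≤ d) :
    desub d (applySub (sig d) w) <+: w := by
  induction w with
  | nil => simp [applySub, desub]
  | cons a w ih =>
    have hw' : ∀ x ∈ w, 1 ≤ x ∧ x ≤ d := fun y hy => hw y (by simp [hy])
    have hih := ih hw'
    have ha := hw a (by simp)
    rw [applySub]
    by_cases h1 : a = 1
    · subst h1
      simpa [sig, desub_one_two, List.cons_prefix_cons] using hih
    by_cases h2 : a = d
    · subst h2
      have hne := applySub_sig_ne_two_cons hw'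
      simp only [sig, h1, if_true, if_false, List.cons_append, List.nil_append]
      generalize applySub (sig a) w = z at hih hne
      cases z with
      | nil => simp [desub]
      | cons y z =>
        have hy : y ≠ 2 := by rintro rfl; exact hne z rfl
        rw [desub_one_cons hy]
        exact List.cons_prefix_cons.2 ⟨rfl, hih⟩
    · simp only [sig, h1, h2, if_false, List.cons_append, List.nil_append]
      rw [desub_cons_of_ne_one (by omega)]
      exact List.cons_prefix_cons.2 ⟨rfl, hih⟩

theorem sigIter_one_prefix_succ (n : ℕ) : sigIter d n [1] <+: sigIter d (n + 1) [1] := by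
  rw [sigIter_succ']
  exact ⟨sigIter d n [2], by simp [← sigIter_append, applySub, sig]⟩

theorem Lang.desub (hd : 3 ≤ d) {u : List ℕ} (hu : Lang d u) : Lang d (desub d u) := by
  obtain ⟨n, hn⟩ := hu
  refine ⟨n, ?_⟩
  have h := desub_infix (d := d) (hn.trans (sigIter_one_prefix_succ n).isInfix)
  rw [sigIter_succ] at h
  exact h.trans (desub_applySub_sig_prefix hd (sigIter_one_mem_Icc hd n)).isInfix

theorem applySub_sig_desub_prefix (hd : 3 ≤ d) (u : List ℕ) (hu : ∀ x ∈ u, 1 ≤ x ∧ x ≤ d)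
    (hc : u.IsChain Succession) (h2 : ∀ v, u ≠ 2 :: v) :
    applySub (sig d) (desub d u) <+: u := by
  match u with
  | [] => simp [desub, applySub]
  | x :: w =>
    have hx := hu x (by simp)
    have hx2 : x ≠ 2 := by rintro rfl; exact h2 w rfl
    have hw : ∀ x ∈ w, 1 ≤ x ∧ x ≤ d := fun y hy => hu y (by simp [hy])
    by_cases h1 : x = 1
    · subst h1
      cases w with
      | nil => simp [desub, applySub]
      | cons y w =>
        by_cases hy : y = 2
        · subst hy
          have hc' := List.isChain_cons_cons.1 hc
          have := applySub_sig_desub_prefix hd w (fun y hy => hw y (by simp [hy])) hc'.2.tail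
            (by
              rintro v rfl
              have := (List.isChain_cons_cons.1 hc'.2).1
              simp [Succession] at this)
          simpa [desub_one_two, applySub, sig, List.cons_prefix_cons] using this
        · have := applySub_sig_desub_prefix hd (y :: w) hw hc.tail (by simp [hy])
          rw [desub_one_cons hy]
          have hd1 : d ≠ 1 := by omega
          simpa [applySub, sig, hd1, List.cons_prefix_cons] using this
    · have := applySub_sig_desub_prefix hd w hw hc.tail (by
        rintro v rfl
        have := (List.isChain_cons_cons.1 hc).1
        simp only [Succession] at this
        omega)
      rw [desub_cons_of_ne_one h1]
      have e1 : x - 1 ≠ 1 := by omega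
      have e2 : x - 1 ≠ d := by omega
      have e3 : x - 1 + 1 = x := by omega
      simpa [applySub, sig, e1, e2, e3, List.cons_prefix_cons] using this
termination_by u.length

theorem length_le_two_mul_length_desub (u : List ℕ) :
    u.length ≤ 2 * (desub d u).length + 1 := by
  match u with
  | [] => simp
  | x :: w =>
    by_cases h1 : x = 1
    · subst h1
      match w with
      | [] => simp
      | y :: w =>
        by_cases hy : y = 2
        · subst hy
          have := length_le_two_mul_length_desub w
          rw [desub_one_two]
          simp only [List.length_cons]
          omega
        · have := length_le_two_mul_length_desub (y :: w)
          rw [desub_one_cons hy]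
          simp only [List.length_cons] at this ⊢
          omega
    · have := length_le_two_mul_length_desub w
      rw [desub_cons_of_ne_one h1]
      simp only [List.length_cons]
      omega
termination_by u.length

theorem desub_cons_one_cons (a : ℕ) (w : List ℕ) :
    desub d (a :: 1 :: w) = (if a = 1 then d else a - 1) :: desub d (1 :: w) := by
  split_ifs with h
  · subst h; exact desub_one_cons (by norm_num) w
  · exact desub_cons_of_ne_one h _

theorem Lang.exists_eq_one_cons (hd : 3 ≤ d) {u : List ℕ} {a b : ℕ} (hab : a ≠ b)
    (ha : Lang d (a :: u)) (hb : Lang d (b :: u)) (hu : u ≠ []) : ∃ w, u = 1 :: w := by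
  obtain ⟨c, w, rfl⟩ := List.exists_cons_of_ne_nil hu
  have h1 := (List.isChain_cons_cons.1 (ha.isChain hd)).1
  have h2 := (List.isChain_cons_cons.1 (hb.isChain hd)).1
  simp only [Succession] at h1 h2
  obtain rfl : c = 1 := by omega
  exact ⟨w, rfl⟩

/-- Sufficiently long left-special words begin with `σⁿ(1)`. -/
theorem exists_sigIter_one_prefix_of_lang_cons (hd : 3 ≤ d) (n : ℕ) :
    ∃ L, ∀ (u : List ℕ) (a b : ℕ), a ≠ b → Lang d (a :: u) → Lang d (b :: u) →
      L ≤ u.length → sigIter d n [1] <+: u := by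
  induction n with
  | zero =>
    refine ⟨1, fun u a b hab ha hb hu => ?_⟩
    obtain ⟨w, rfl⟩ := ha.exists_eq_one_cons hd hab hb (by rintro rfl; simp at hu)
    exact ⟨w, rfl⟩
  | succ n ih =>
    obtain ⟨L, hL⟩ := ih
    refine ⟨2 * L + 2, fun u a b hab ha hb hu => ?_⟩
    obtain ⟨w, rfl⟩ := ha.exists_eq_one_cons hd hab hb (by rintro rfl; simp at hu)
    have ha' := ha.mem_Icc hd a (by simp)
    have hb' := hb.mem_Icc hd b (by simp)
    have hua : Lang d (1 :: w) := ha.of_infix (List.suffix_cons _ _).isInfix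
    have hlen := length_le_two_mul_length_desub (d := d) (1 :: w)
    have da := ha.desub hd
    have db := hb.desub hd
    rw [desub_cons_one_cons] at da db
    have := hL _ _ _ (by split_ifs <;> omega) da db (by omega)
    rw [sigIter_succ]
    exact (applySub_prefix _ this).trans
      (applySub_sig_desub_prefix hd _ (hua.mem_Icc hd) (hua.isChain hd) (by simp))

theorem sigIter_suffix_of_suffix_one {n : ℕ} (h : [1] <:+ sigIter d n [1]) {j : ℕ} (hj : j < d) :
    [j + 1] <:+ sigIter d (n + j) [1] := by
  induction j with
  | zero => exact h
  | succ j ih =>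
    obtain ⟨p, hp⟩ := ih (by omega)
    have hjd : j + 1 ≠ d := by omega
    rw [← Nat.add_assoc, sigIter_succ, ← hp, applySub_append]
    refine List.IsSuffix.trans ?_ (List.suffix_append _ _)
    by_cases h0 : j = 0
    · subst h0; exact ⟨[1], by simp [applySub, sig]⟩
    · simp [applySub, sig, hjd, h0]

theorem one_suffix_sigIter_mul (hd : 3 ≤ d) (k : ℕ) : [1] <:+ sigIter d (d * k) [1] := by
  induction k with
  | zero => simp [sigIter_zero]
  | succ k ih =>
    obtain ⟨p, hp⟩ := sigIter_suffix_of_suffix_one ih (j := d - 1) (by omega)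
    have e : d * (k + 1) = d * k + (d - 1) + 1 := by rw [Nat.mul_succ]; omega
    rw [e, sigIter_succ, ← hp, applySub_append, show d - 1 + 1 = d by omega]
    have : d ≠ 1 := by omega
    simp [applySub, sig, this]

theorem sigIter_two {j : ℕ} (hj : j + 2 ≤ d) : sigIter d j [2] = [j + 2] := by
  induction j with
  | zero => rfl
  | succ j ih =>
    have : j + 2 ≠ d := by omega
    simp [sigIter_succ, ih (by omega), applySub, sig, this]

theorem lang_one_one (hd : 3 ≤ d) : Lang d [1, 1] := by
  have h2 : sigIter d d [2] = [1, 2] := by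
    have h := sigIter_two (d := d) (j := d - 2) (by omega)
    rw [show d - 2 + 2 = d by omega] at h
    have hd1 : d ≠ 1 := by omega
    calc sigIter d d [2] = sigIter d (d - 2 + 1 + 1) [2] := by congr 1; omega
      _ = [1, 2] := by simp [sigIter_succ, h, applySub, sig, hd1]
  obtain ⟨p, hp⟩ := one_suffix_sigIter_mul hd 1
  rw [Nat.mul_one] at hp
  refine ⟨d + 1, p, [2], ?_⟩
  have : sigIter d (d + 1) [1] = sigIter d d [1] ++ sigIter d d [2] := by
    rw [sigIter_succ', ← sigIter_append]; simp [applySub, sig]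
  rw [this, h2, ← hp]
  simp

theorem lang_cons_sigIter_of_suffix (hd : 3 ≤ d) {a n : ℕ} (h : [a] <:+ sigIter d n [1]) :
    Lang d (a :: sigIter d n [1]) := by
  have h11 := (lang_one_one hd).sigIter n
  rw [show [1, 1] = [1] ++ [1] from rfl, sigIter_append] at h11
  refine h11.of_infix ?_
  obtain ⟨p, hp⟩ := h
  exact ⟨p, [], by nth_rewrite 2 [← hp]; simp⟩

theorem shiftMap_iterate_apply (n : ℕ) (V : ℕ → ℕ) (i : ℕ) : shiftMap^[n] V i = V (n + i) := by
  induction n generalizing V with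
  | zero => simp
  | succ n ih =>
    rw [Function.iterate_succ_apply, ih]
    simp only [shiftMap]
    congr 1
    omega

variable {ω : ℕ → ℕ}

theorem mem_OmegaPlus_iff {V : ℕ → ℕ} :
    V ∈ OmegaPlus ω ↔ ∀ n, ∃ m, ∀ i < n, V i = ω (m + i) := by
  rw [OmegaPlus, (PiNat.isTopologicalBasis_cylinders (fun _ => ℕ)).mem_closure_iff]
  constructor
  · intro h n
    obtain ⟨_, hy, m, rfl⟩ := h _ ⟨V, n, rfl⟩ (PiNat.self_mem_cylinder V n)
    refine ⟨m, fun i hi => ?_⟩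
    rw [← shiftMap_iterate_apply m ω]
    exact (hy i hi).symm
  · rintro h _ ⟨x, n, rfl⟩ hV
    obtain ⟨m, hm⟩ := h n
    refine ⟨_, fun i hi => ?_, m, rfl⟩
    rw [shiftMap_iterate_apply, ← hm i hi]
    exact hV i hi

theorem IsSigmaFixedPoint.lang_map_range (hω : IsSigmaFixedPoint d ω) (m n : ℕ) :
    Lang d ((List.range n).map fun i => ω (m + i)) := by
  refine ⟨m + n, ?_⟩
  have hlen := lt_length_sigIter_one (d := d) (m + n)
  have : (List.range n).map (fun i => ω (m + i)) = ((sigIter d (m + n) [1]).drop m).take n := by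
    apply List.ext_getElem
    · simp; omega
    · intro i h1 h2
      simp only [List.length_map, List.length_range] at h1
      simpa using (hω (m + n) (m + i) (by omega)).symm
  rw [this]
  exact (List.take_prefix _ _).isInfix.trans (List.drop_suffix _ _).isInfix

theorem IsSigmaFixedPoint.mem_OmegaPlus_iff_lang (hω : IsSigmaFixedPoint d ω) {V : ℕ → ℕ} :
    V ∈ OmegaPlus ω ↔ ∀ n, Lang d ((List.range n).map V) := by
  rw [mem_OmegaPlus_iff]
  refine forall_congr' fun n => ⟨?_, ?_⟩
  · rintro ⟨m, hm⟩
    have : (List.range n).map V = (List.range n).map fun i => ω (m + i) :=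
      List.map_congr_left fun i hi => hm i (List.mem_range.1 hi)
    rw [this]
    exact hω.lang_map_range m n
  · rintro ⟨N, s, t, h⟩
    refine ⟨s.length, fun i hi => ?_⟩
    have hlen : s.length + i < (sigIter d N [1]).length := by
      rw [← h]; simp; omega
    rw [← hω N _ hlen]
    simp only [List.get_eq_getElem, ← h]
    simp [hi]

theorem map_range_succ_consInf (a n : ℕ) (V : ℕ → ℕ) :
    (List.range (n + 1)).map (consInf a V) = a :: (List.range n).map V := by
  simp [List.range_succ_eq_map, consInf, Function.comp_def]

theorem IsSigmaFixedPoint.map_range_prefix (hω : IsSigmaFixedPoint d ω) {n N : ℕ}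
    (h : n ≤ (sigIter d N [1]).length) : (List.range n).map ω <+: sigIter d N [1] := by
  rw [List.prefix_iff_eq_take]
  apply List.ext_getElem
  · simp; omega
  · intro i h1 h2
    simp only [List.length_map, List.length_range] at h1
    simpa using (hω N i (by omega)).symm

theorem IsSigmaFixedPoint.consInf_mem_OmegaPlus (hω : IsSigmaFixedPoint d ω) (hd : 3 ≤ d) {a : ℕ}
    (h1 : 1 ≤ a) (had : a ≤ d) : consInf a ω ∈ OmegaPlus ω := by
  rw [hω.mem_OmegaPlus_iff_lang]
  intro n
  have hs := sigIter_suffix_of_suffix_one (one_suffix_sigIter_mul hd n) (j := a - 1) (by omega)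
  rw [Nat.sub_add_cancel h1] at hs
  have hl := lt_length_sigIter_one (d := d) (d * n + (a - 1))
  have hn : n ≤ d * n := Nat.le_mul_of_pos_left n (by omega)
  have hp := List.cons_prefix_cons.2
    ⟨rfl (a := a), hω.map_range_prefix (n := n) (N := d * n + (a - 1)) (by omega)⟩
  have hL := (lang_cons_sigIter_of_suffix hd hs).of_infix hp.isInfix
  rw [← map_range_succ_consInf, List.range_succ, List.map_append] at hL
  exact hL.of_infix (List.prefix_append _ _).isInfix

theorem IsSigmaFixedPoint.eq_of_forall_prefix (hω : IsSigmaFixedPoint d ω) {V : ℕ → ℕ}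
    (h : ∀ n, ∃ N, sigIter d n [1] <+: (List.range N).map V) : V = ω := by
  funext i
  have hl := lt_length_sigIter_one (d := d) i
  obtain ⟨N, hN⟩ := h i
  rw [← hω i i hl, List.get_eq_getElem, hN.getElem hl]
  simp

end Substitution

/-- ω is the unique left-special element of Ω⁺: V ∈ Ω⁺ admits distinct letters
a, b ∈ A with aV ∈ Ω⁺ and bV ∈ Ω⁺ iff V = ω. -/
theorem stmt_8 (d : ℕ) (hd : 3 ≤ d) (ω : ℕ → ℕ) (hω : IsSigmaFixedPoint d ω)
    (V : ℕ → ℕ) (hV : V ∈ OmegaPlus ω) :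
    (∃ a b : ℕ, a ≠ b ∧ 1 ≤ a ∧ a ≤ d ∧ 1 ≤ b ∧ b ≤ d ∧
      consInf a V ∈ OmegaPlus ω ∧ consInf b V ∈ OmegaPlus ω) ↔ V = ω := by
  constructor
  · rintro ⟨a, b, hab, -, -, -, -, ha, hb⟩
    rw [hω.mem_OmegaPlus_iff_lang] at ha hb
    refine hω.eq_of_forall_prefix fun n => ?_
    obtain ⟨L, hL⟩ := exists_sigIter_one_prefix_of_lang_cons hd n
    have hLa := ha (L + 1)
    have hLb := hb (L + 1)
    rw [map_range_succ_consInf] at hLa hLb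
    exact ⟨L, hL _ a b hab hLa hLb (by simp)⟩
  · rintro rfl
    exact ⟨1, 2, by norm_num, le_rfl, by omega, by norm_num, by omega,
      hω.consInf_mem_OmegaPlus hd le_rfl (by omega),
      hω.consInf_mem_OmegaPlus hd (by norm_num) (by omega)⟩
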